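/- arXiv:2306.12668 — 3 statements merged into one kernel-verified Lean document; each statement's English description precedes it below -/
import Mathlib

section
/- For every s ∈ ℝ one has ζ(s)² ≤ 2 L_ζ^{-1} · Ξ(s). -/
lemma zeta_aux (f : ℝ → ℝ) (K : ℝ) (hK : 0 < K) (hm : Monotone f)
    (hl : ∀ x y : ℝ, |f x - f y| ≤ K * |x - y|) (h0 : f 0 = 0) (s : ℝ) (hs : 0 ≤ s) :
    (f s) ^ 2 ≤ 2 * K * ∫ r in (0:ℝ)..s, f r := by
  have hi : ∀ a b : ℝ, IntervalIntegrable f MeasureTheory.volume a b :=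
    fun a b => hm.intervalIntegrable
  have ha : 0 ≤ f s := h0 ▸ hm hs
  have hle : f s ≤ K * s := by
    have := hl s 0
    rw [h0, sub_zero, sub_zero, abs_of_nonneg ha, abs_of_nonneg hs] at this
    exact this
  obtain ⟨t, ht⟩ : ∃ t, f s = K * (s - t) := ⟨s - f s / K, by field_simp; ring⟩
  have ht0 : 0 ≤ t := by nlinarith
  have hts : t ≤ s := by
    have : 0 ≤ s - t := by
      rw [ht] at ha
      exact nonneg_of_mul_nonneg_right ha hK
    linarith
  have h1 : 0 ≤ ∫ r in (0:ℝ)..t, f r :=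
    intervalIntegral.integral_nonneg ht0 fun r hr => h0 ▸ hm hr.1
  have h2 : (∫ r in t..s, K * (r - t)) ≤ ∫ r in t..s, f r := by
    apply intervalIntegral.integral_mono_on hts
    · exact Continuous.intervalIntegrable (by fun_prop) _ _
    · exact hi _ _
    · intro r hr
      have := hl s r
      rw [abs_of_nonneg (sub_nonneg.2 hr.2)] at this
      have := (abs_le.1 this).2
      rw [ht] at this
      linarith
  have h3 : (∫ r in t..s, K * (r - t)) = K * ((s - t) ^ 2 / 2) := by
    rw [intervalIntegral.integral_const_mul,
      intervalIntegral.integral_comp_sub_right (fun x => x) t, integral_id]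
    ring
  have h4 := intervalIntegral.integral_add_adjacent_intervals (hi 0 t) (hi t s)
  rw [← h4]
  rw [h3] at h2
  rw [ht]
  have := mul_le_mul_of_nonneg_left (add_le_add h1 h2) (by positivity : 0 ≤ 2 * K)
  calc _ = 2 * K * (0 + K * ((s - t) ^ 2 / 2)) := by ring
    _ ≤ _ := this


/-- For `ζ : ℝ → ℝ` nondecreasing, Lipschitz with constant `Lζ⁻¹` (`Lζ > 0`),
`ζ(0) = 0`, and `Ξ z = ∫₀^z ζ(s) ds`, one has `ζ(s)² ≤ 2 Lζ⁻¹ Ξ(s)` for all `s`. -/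
theorem zeta_sq_le_xi (ζ : ℝ → ℝ) (Lζ : ℝ) (hL : 0 < Lζ)
    (hmono : Monotone ζ)
    (hlip : ∀ x y : ℝ, |ζ x - ζ y| ≤ Lζ⁻¹ * |x - y|)
    (hζ0 : ζ 0 = 0)
    (Ξ : ℝ → ℝ) (hΞ : ∀ z : ℝ, Ξ z = ∫ s in (0:ℝ)..z, ζ s) :
    ∀ s : ℝ, (ζ s) ^ 2 ≤ 2 * Lζ⁻¹ * Ξ s := by
  intro s
  have hK : 0 < Lζ⁻¹ := inv_pos.2 hL
  rw [hΞ]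
  rcases le_total 0 s with hs | hs
  · exact zeta_aux ζ _ hK hmono hlip hζ0 s hs
  · have h := zeta_aux (fun x => -ζ (-x)) Lζ⁻¹ hK
      (fun x y hxy => neg_le_neg (hmono (neg_le_neg hxy)))
      (fun x y => by
        have := hlip (-y) (-x)
        rw [show -ζ (-x) - -ζ (-y) = ζ (-y) - ζ (-x) by ring]
        rwa [show -y - -x = x - y by ring] at this)
      (by simp [hζ0]) (-s) (by linarith)
    rw [intervalIntegral.integral_neg, intervalIntegral.integral_comp_neg (fun x => ζ x),
      ← intervalIntegral.integral_symm] at h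
    simpa using h
end

section
/- Let β ∈ (0,1). There exists a constant C depending only on β and T such that for every strongly measurable v : (0,T) → V whose H^β(0,T;V) norm is finite and every s ∈ [0,T], one has ∫₀^{T−s} ‖v(t+s) − v(t)‖_V² dt ≤ C · s^{2β} · ‖v‖²_{H^β(0,T;V)}. -/
open MeasureTheory

theorem aux_point {V : Type} [NormedAddCommGroup V] (β s : ℝ) (hβ : 0 < β) (x y z : V) (d : ℝ) (e : ℝ)
    (hd : 0 < d) (hds : d ≤ s) (he : 0 < e) (hes : e ≤ s) :
    (‖x - y‖₊ : ENNReal) ^ 2 ≤ ENNReal.ofReal (2 * s ^ (1 + 2 * β)) *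
      ((‖x - z‖₊ : ENNReal) ^ 2 / ENNReal.ofReal (d ^ (1 + 2 * β))
        + (‖y - z‖₊ : ENNReal) ^ 2 / ENNReal.ofReal (e ^ (1 + 2 * β))) := by
  have hdp : 0 < d ^ (1 + 2 * β) := Real.rpow_pos_of_pos hd _
  have hep : 0 < e ^ (1 + 2 * β) := Real.rpow_pos_of_pos he _
  have h1 : d ^ (1 + 2 * β) ≤ s ^ (1 + 2 * β) :=
    Real.rpow_le_rpow hd.le hds (by linarith)
  have h2 : e ^ (1 + 2 * β) ≤ s ^ (1 + 2 * β) :=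
    Real.rpow_le_rpow he.le hes (by linarith)
  have key : ‖x - y‖ ^ 2 ≤ (2 * s ^ (1 + 2 * β)) *
      (‖x - z‖ ^ 2 / d ^ (1 + 2 * β) + ‖y - z‖ ^ 2 / e ^ (1 + 2 * β)) := by
    have a1 : ‖x - z‖ ^ 2 ≤ s ^ (1 + 2 * β) * (‖x - z‖ ^ 2 / d ^ (1 + 2 * β)) := by
      rw [mul_div_assoc', le_div_iff₀ hdp, mul_comm]
      gcongr
    have a2 : ‖y - z‖ ^ 2 ≤ s ^ (1 + 2 * β) * (‖y - z‖ ^ 2 / e ^ (1 + 2 * β)) := by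
      rw [mul_div_assoc', le_div_iff₀ hep, mul_comm]
      gcongr
    have a3 : ‖x - y‖ ≤ ‖x - z‖ + ‖y - z‖ := by
      have := norm_sub_le (x - z) (y - z)
      simpa using this
    nlinarith [sq_nonneg (‖x - z‖ - ‖y - z‖), norm_nonneg (x - y)]
  have conv : ∀ w : V, (‖w‖₊ : ENNReal) ^ 2 = ENNReal.ofReal (‖w‖ ^ 2) := by
    intro w
    rw [ENNReal.ofReal_pow (norm_nonneg _), ofReal_norm]
    rfl
  rw [conv, conv, conv, ← ENNReal.ofReal_div_of_pos hdp, ← ENNReal.ofReal_div_of_pos hep,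
    ← ENNReal.ofReal_add (by positivity) (by positivity), ← ENNReal.ofReal_mul (by linarith)]
  exact ENNReal.ofReal_le_ofReal key

/-- Fractional Sobolev (H^β) bound on time translates: for `β ∈ (0,1)` and `T > 0`
there is `C` depending only on `β` and `T` such that, for every Banach space `V` and
every strongly measurable `v : (0,T) → V` with finite `H^β(0,T;V)` norm, and every
`s ∈ [0,T]`,
`∫₀^{T−s} ‖v(t+s) − v(t)‖² dt ≤ C s^{2β} ‖v‖²_{H^β(0,T;V)}`. -/
theorem translate_estimate_of_fractional_sobolev (β T : ℝ)
    (hβ : β ∈ Set.Ioo (0:ℝ) 1) (hT : 0 < T) :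
    ∃ C : ℝ, 0 < C ∧
      ∀ (V : Type) [NormedAddCommGroup V] (v : ℝ → V),
        StronglyMeasurable v →
        ((∫⁻ t in Set.Ioo (0:ℝ) T, (‖v t‖₊ : ENNReal) ^ 2)
          + ∫⁻ t in Set.Ioo (0:ℝ) T, ∫⁻ s in Set.Ioo (0:ℝ) T,
              (‖v t - v s‖₊ : ENNReal) ^ 2 / ENNReal.ofReal (|t - s| ^ (1 + 2 * β))) ≠ ⊤ →
        ∀ s ∈ Set.Icc (0:ℝ) T,
          (∫⁻ t in Set.Ioo (0:ℝ) (T - s), (‖v (t + s) - v t‖₊ : ENNReal) ^ 2)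
            ≤ ENNReal.ofReal (C * s ^ (2 * β)) *
              ((∫⁻ t in Set.Ioo (0:ℝ) T, (‖v t‖₊ : ENNReal) ^ 2)
                + ∫⁻ t in Set.Ioo (0:ℝ) T, ∫⁻ s' in Set.Ioo (0:ℝ) T,
                    (‖v t - v s'‖₊ : ENNReal) ^ 2
                      / ENNReal.ofReal (|t - s'| ^ (1 + 2 * β))) := by
  obtain ⟨hβ0, hβ1⟩ := hβ
  refine ⟨4, by norm_num, ?_⟩
  intro V _ v hv _ s hs
  obtain ⟨hs0, hsT⟩ := hs
  rcases hs0.eq_or_lt with rfl | hs0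
  · simp
  set K : ℝ → ℝ → ENNReal := fun t r =>
    (‖v t - v r‖₊ : ENNReal) ^ 2 / ENNReal.ofReal (|t - r| ^ (1 + 2 * β)) with hK
  have hKm : Measurable (Function.uncurry K) := by
    have h1 : StronglyMeasurable (fun p : ℝ × ℝ => v p.1 - v p.2) :=
      (hv.comp_measurable measurable_fst).sub (hv.comp_measurable measurable_snd)
    have h2 : Measurable (fun p : ℝ × ℝ => (‖v p.1 - v p.2‖₊ : ENNReal)) := h1.enorm
    have h3 : Measurable (fun p : ℝ × ℝ => ENNReal.ofReal (|p.1 - p.2| ^ (1 + 2 * β))) := by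
      fun_prop
    exact (h2.pow_const 2).div h3
  set G : ℝ → ENNReal := fun t => ∫⁻ r in Set.Ioo (0:ℝ) T, K t r with hG
  have hGm : Measurable G := hKm.lintegral_prod_right'
  have hpt : ∀ t ∈ Set.Ioo (0:ℝ) (T - s), (‖v (t + s) - v t‖₊ : ENNReal) ^ 2 ≤
      ENNReal.ofReal (2 * s ^ (2 * β)) * (G (t + s) + G t) := by
    intro t ht
    have hsub : Set.Ioo t (t + s) ⊆ Set.Ioo 0 T := by
      intro r hr
      exact ⟨ht.1.trans hr.1, by linarith [hr.2, ht.2]⟩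
    have e1 : (‖v (t + s) - v t‖₊ : ENNReal) ^ 2 * ENNReal.ofReal s ≤
        ENNReal.ofReal (2 * s ^ (1 + 2 * β)) * (G (t + s) + G t) := by
      calc (‖v (t + s) - v t‖₊ : ENNReal) ^ 2 * ENNReal.ofReal s
          = ∫⁻ r in Set.Ioo t (t + s), (‖v (t + s) - v t‖₊ : ENNReal) ^ 2 := by
            rw [setLIntegral_const, Real.volume_Ioo]
            simp
        _ ≤ ∫⁻ r in Set.Ioo t (t + s),
              ENNReal.ofReal (2 * s ^ (1 + 2 * β)) * (K (t + s) r + K t r) := by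
            refine setLIntegral_mono' measurableSet_Ioo ?_
            intro r hr
            have p1 : 0 < |t + s - r| := abs_pos.2 (by linarith [hr.2])
            have p2 : 0 < |t - r| := abs_pos.2 (by linarith [hr.1])
            have p3 : |t + s - r| ≤ s := by
              rw [abs_le]; constructor <;> linarith [hr.1, hr.2]
            have p4 : |t - r| ≤ s := by
              rw [abs_le]; constructor <;> linarith [hr.1, hr.2]
            exact aux_point β s hβ0 _ _ (v r) _ _ p1 p3 p2 p4
        _ ≤ ∫⁻ r in Set.Ioo 0 T,
              ENNReal.ofReal (2 * s ^ (1 + 2 * β)) * (K (t + s) r + K t r) :=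
            lintegral_mono_set hsub
        _ = _ := by
            rw [lintegral_const_mul' _ _ ENNReal.ofReal_ne_top,
              lintegral_add_left (hKm.of_uncurry_left (x := t + s))]
    have hs' : ENNReal.ofReal s ≠ 0 := by simpa using hs0
    refine (ENNReal.mul_le_mul_iff_left hs' ENNReal.ofReal_ne_top).1 (e1.trans_eq ?_)
    rw [mul_right_comm, ← ENNReal.ofReal_mul (by positivity), Real.rpow_add hs0, Real.rpow_one]
    congr 2
    ring
  have hshift : ∫⁻ t in Set.Ioo (0:ℝ) (T - s), G (t + s) ≤ ∫⁻ t in Set.Ioo (0:ℝ) T, G t := by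
    have hmp := measurePreserving_add_right (volume : Measure ℝ) s
    have := hmp.setLIntegral_comp_preimage (s := Set.Ioo s T) measurableSet_Ioo hGm
    have hpre : (fun x => x + s) ⁻¹' Set.Ioo s T = Set.Ioo 0 (T - s) := by
      simp
    rw [hpre] at this
    rw [this]
    exact lintegral_mono_set (Set.Ioo_subset_Ioo_left hs0.le)
  calc ∫⁻ t in Set.Ioo (0:ℝ) (T - s), (‖v (t + s) - v t‖₊ : ENNReal) ^ 2
      ≤ ∫⁻ t in Set.Ioo (0:ℝ) (T - s),
          ENNReal.ofReal (2 * s ^ (2 * β)) * (G (t + s) + G t) :=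
        setLIntegral_mono' measurableSet_Ioo hpt
    _ = ENNReal.ofReal (2 * s ^ (2 * β)) * ((∫⁻ t in Set.Ioo (0:ℝ) (T - s), G (t + s))
          + ∫⁻ t in Set.Ioo (0:ℝ) (T - s), G t) := by
        rw [lintegral_const_mul' _ _ ENNReal.ofReal_ne_top, lintegral_add_right _ hGm]
    _ ≤ ENNReal.ofReal (2 * s ^ (2 * β)) * ((∫⁻ t in Set.Ioo (0:ℝ) T, G t)
          + ∫⁻ t in Set.Ioo (0:ℝ) T, G t) := by
        gcongr
        linarith
    _ = ENNReal.ofReal (4 * s ^ (2 * β)) * ∫⁻ t in Set.Ioo (0:ℝ) T, G t := by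
        rw [← two_mul, ← mul_assoc]
        congr 1
        rw [show (2 : ENNReal) = ENNReal.ofReal 2 by simp, ← ENNReal.ofReal_mul (by positivity)]
        congr 1
        ring
    _ ≤ _ := by
        gcongr
        exact le_add_self
end

section
/- Fractional Sobolev bound for piecewise-constant-in-time functions: let β ∈ (0, 1/2). There exists a constant C depending only on β and T such that, for every choice of v^1, …, v^N ∈ V and every A ≥ 0 satisfying δt · Σ_{n=1}^{N−ℓ} ‖v^{n+ℓ} − v^n‖_V² ≤ A · t_ℓ for all ℓ ∈ {1, …, N−1}, the piecewise-constant function v defined by v(t) := v^n for t ∈ (t_{n−1}, t_n] satisfies ∫₀^T ∫₀^T ‖v(t) − v(s)‖_V² / |t − s|^{1+2β} dt ds ≤ C · A (with C independent of N). -/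
open MeasureTheory

lemma aux_nnnorm_rev {V : Type} [NormedAddCommGroup V] (a b : V) : ‖a - b‖₊ = ‖b - a‖₊ :=
  NNReal.eq (norm_sub_rev a b)

/-- Auxiliary step function. -/
noncomputable def auxQ {V : Type} [NormedAddCommGroup V] (vs : ℕ → V) (N : ℕ) (τ : ℝ)
    (k : ℕ) (w : ℝ) (t : ℝ) : ENNReal :=
  ∑ m ∈ Finset.Icc 1 (N - k),
    (Set.Ioc ((m:ℝ) * τ - w) (m * τ)).indicator
      (fun _ => (‖vs (m + k) - vs m‖₊ : ENNReal) ^ 2) t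

lemma auxQ_meas {V : Type} [NormedAddCommGroup V] (vs : ℕ → V) (N : ℕ) (τ : ℝ)
    (k : ℕ) (w : ℝ) : Measurable (auxQ vs N τ k w) := by
  unfold auxQ
  refine Finset.measurable_fun_sum _ fun m _ => ?_
  exact measurable_const.indicator measurableSet_Ioc

lemma auxQ_int {V : Type} [NormedAddCommGroup V] (vs : ℕ → V) (N : ℕ) (τ : ℝ) (A : ℝ)
    (hA : 0 ≤ A) (k : ℕ) (w : ℝ) (hw : 0 ≤ w)
    (h : ∑ n ∈ Finset.Icc 1 (N - k), ‖vs (n + k) - vs n‖ ^ 2 ≤ A * k) :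
    ∫⁻ t, auxQ vs N τ k w t ≤ ENNReal.ofReal (w * (A * k)) := by
  unfold auxQ
  rw [lintegral_finsetSum _ (fun m _ => measurable_const.indicator measurableSet_Ioc)]
  simp_rw [lintegral_indicator_const measurableSet_Ioc, Real.volume_Ioc]
  have e : ∀ m : ℕ, (‖vs (m + k) - vs m‖₊ : ENNReal) ^ 2
      = ENNReal.ofReal (‖vs (m + k) - vs m‖ ^ 2) := by
    intro m
    rw [ENNReal.ofReal_pow (norm_nonneg _), ofReal_norm]; rfl
  simp_rw [e, sub_sub_cancel]
  rw [← Finset.sum_mul, ← ENNReal.ofReal_sum_of_nonneg (fun _ _ => by positivity),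
    ← ENNReal.ofReal_mul (Finset.sum_nonneg fun _ _ => by positivity), mul_comm]
  exact ENNReal.ofReal_le_ofReal (mul_le_mul_of_nonneg_left h hw)

lemma auxQ_ge {V : Type} [NormedAddCommGroup V] (vs : ℕ → V) (N : ℕ) (τ : ℝ)
    (k : ℕ) (w : ℝ) (t : ℝ) (m : ℕ) (hm : 1 ≤ m) (hmk : m + k ≤ N)
    (h1 : m * τ - w < t) (h2 : t ≤ m * τ) :
    (‖vs (m + k) - vs m‖₊ : ENNReal) ^ 2 ≤ auxQ vs N τ k w t := by
  unfold auxQ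
  refine le_trans ?_ (Finset.single_le_sum (fun _ _ => zero_le)
    (Finset.mem_Icc.2 ⟨hm, by omega⟩ : m ∈ Finset.Icc 1 (N - k)))
  rw [Set.indicator_of_mem (Set.mem_Ioc.2 ⟨h1, h2⟩)]

lemma ceil_facts (T : ℝ) (hT : 0 < T) (N : ℕ) (hN : 1 ≤ N) (t : ℝ) (h0 : 0 < t) (h1 : t < T) :
    1 ≤ ⌈t * N / T⌉₊ ∧ ⌈t * N / T⌉₊ ≤ N ∧ (⌈t * N / T⌉₊ : ℝ) * (T / N) - (T / N) < t ∧
      t ≤ (⌈t * N / T⌉₊ : ℝ) * (T / N) := by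
  have hN' : (0:ℝ) < N := by exact_mod_cast hN
  have hp : 0 < t * N / T := by positivity
  have e : t = (t * N / T) * (T / N) := by field_simp
  have hτ : 0 < T / N := by positivity
  refine ⟨Nat.one_le_iff_ne_zero.2 (Nat.ceil_pos.2 hp).ne', ?_, ?_, ?_⟩
  · refine Nat.ceil_le.2 ?_
    rw [div_le_iff₀ hT]; nlinarith
  · have := Nat.ceil_lt_add_one hp.le
    nlinarith
  · have := Nat.le_ceil (t * N / T)
    nlinarith

lemma shift_bound (T : ℝ) (hT : 0 < T) (N : ℕ) (hN : 1 ≤ N) {V : Type} [NormedAddCommGroup V]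
    (vs : ℕ → V) (A : ℝ) (hA : 0 ≤ A)
    (H : ∀ ℓ : ℕ, 1 ≤ ℓ → ∑ n ∈ Finset.Icc 1 (N - ℓ), ‖vs (n + ℓ) - vs n‖ ^ 2 ≤ A * ℓ)
    (h : ℝ) (hh : 0 < h) :
    ∫⁻ t, (if t ∈ Set.Ioo 0 T ∧ t + h ∈ Set.Ioo 0 T then
      (‖vs ⌈t * N / T⌉₊ - vs ⌈(t + h) * N / T⌉₊‖₊ : ENNReal) ^ 2 else 0)
      ≤ ENNReal.ofReal (3 * A * h) := by
  have hN' : (0:ℝ) < N := by exact_mod_cast hN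
  set τ : ℝ := T / N with hτd
  have hτ : 0 < τ := by positivity
  rcases lt_or_ge h τ with hlt | hge
  · refine le_trans (lintegral_mono (g := auxQ vs N τ 1 h) fun t => ?_)
      ((auxQ_int vs N τ A hA 1 h hh.le (H 1 le_rfl)).trans
        (ENNReal.ofReal_le_ofReal (by push_cast; nlinarith)))
    dsimp only
    split_ifs with hc
    · obtain ⟨⟨a1, a2⟩, b1, b2⟩ := hc
      obtain ⟨m1, m2, m3, m4⟩ := ceil_facts T hT N hN t a1 a2
      obtain ⟨n1, n2, n3, n4⟩ := ceil_facts T hT N hN (t + h) b1 b2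
      generalize ⌈t * N / T⌉₊ = m at *
      generalize ⌈(t + h) * N / T⌉₊ = n at *
      rw [← hτd] at *
      have c1 : m ≤ n := by
        have : (m:ℝ) < n + 1 := by
          by_contra hcon
          push Not at hcon
          nlinarith
        exact_mod_cast Nat.lt_succ_iff.1 (by exact_mod_cast this)
      have c2 : n < m + 2 := by
        have : (n:ℝ) < m + 2 := by
          by_contra hcon
          push Not at hcon
          nlinarith
        exact_mod_cast this
      obtain rfl | rfl : n = m ∨ n = m + 1 := by omega
      · simp
      · rw [aux_nnnorm_rev]
        refine auxQ_ge vs N τ 1 h t m m1 n2 ?_ m4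
        push_cast at n3
        nlinarith
    · exact zero_le
  · set l := ⌊h / τ⌋₊ with hl
    have l1 : 1 ≤ l := Nat.le_floor (by rw [Nat.cast_one, le_div_iff₀ hτ]; linarith)
    have l2 : l * τ ≤ h := by
      have := Nat.floor_le (show 0 ≤ h / τ by positivity)
      rwa [le_div_iff₀ hτ] at this
    have l3 : h < (l + 1) * τ := by
      have := Nat.lt_floor_add_one (h / τ)
      rwa [div_lt_iff₀ hτ] at this
    have l1' : (1:ℝ) ≤ l := by exact_mod_cast l1
    have key : τ * (A * l) + τ * (A * ((l + 1 : ℕ) : ℝ)) ≤ 3 * A * h := by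
      push_cast
      have : τ * l + τ * (l + 1) ≤ 3 * h := by nlinarith
      nlinarith
    refine le_trans (lintegral_mono (g := fun t => auxQ vs N τ l τ t + auxQ vs N τ (l+1) τ t)
      fun t => ?_) ?_
    · dsimp only
      split_ifs with hc
      · obtain ⟨⟨a1, a2⟩, b1, b2⟩ := hc
        obtain ⟨m1, m2, m3, m4⟩ := ceil_facts T hT N hN t a1 a2
        obtain ⟨n1, n2, n3, n4⟩ := ceil_facts T hT N hN (t + h) b1 b2
        generalize ⌈t * N / T⌉₊ = m at *
        generalize ⌈(t + h) * N / T⌉₊ = n at *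
        rw [← hτd] at *
        have c1 : m + l < n + 1 := by
          have : (m:ℝ) + l < n + 1 := by
            by_contra hcon
            push Not at hcon
            nlinarith
          exact_mod_cast this
        have c2 : n < m + l + 2 := by
          have : (n:ℝ) < m + l + 2 := by
            by_contra hcon
            push Not at hcon
            nlinarith
          exact_mod_cast this
        rw [aux_nnnorm_rev]
        obtain rfl | rfl : n = m + l ∨ n = m + (l + 1) := by omega
        · exact (auxQ_ge vs N τ l τ t m m1 n2 m3 m4).trans le_self_add
        · exact (auxQ_ge vs N τ (l+1) τ t m m1 n2 m3 m4).trans le_add_self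
      · exact zero_le
    · rw [lintegral_add_left (auxQ_meas ..)]
      refine (add_le_add (auxQ_int vs N τ A hA l τ hτ.le (H l l1))
        (auxQ_int vs N τ A hA (l+1) τ hτ.le (H (l+1) (by omega)))).trans ?_
      rw [← ENNReal.ofReal_add (by positivity) (by positivity)]
      exact ENNReal.ofReal_le_ofReal key

lemma kernel_fin (β T : ℝ) (hβ : β ∈ Set.Ioo (0:ℝ) (1/2)) (hT : 0 < T) :
    ∫⁻ h in Set.Ioo (-T) T, ENNReal.ofReal (|h| ^ (-2 * β)) ≠ ⊤ := by
  have i1 : IntervalIntegrable (fun x : ℝ => |x| ^ (-2 * β)) volume 0 T := by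
    refine (intervalIntegral.intervalIntegrable_rpow' (r := -2 * β)
      (by linarith [hβ.2])).congr ?_
    intro x hx
    rw [Set.uIoc_of_le hT.le] at hx
    simp only [abs_of_pos hx.1]
  have i2 : IntervalIntegrable (fun x : ℝ => |x| ^ (-2 * β)) volume (-T) 0 := by
    have := ((IntervalIntegrable.iff_comp_neg (by simp)).1 i1).symm
    simpa using this
  have i3 := (intervalIntegrable_iff_integrableOn_Ioo_of_le (by linarith)).1 (i2.trans i1)
  have := i3.lintegral_lt_top
  exact this.ne

/-- Fractional Sobolev bound for piecewise-constant-in-time functions: let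
`β ∈ (0, 1/2)` and `T > 0`. There exists `C` depending only on `β` and `T`
(in particular independent of `N`) such that, for every `v¹, …, v^N ∈ V` and
every `A ≥ 0` with `δt Σ_{n=1}^{N−ℓ} ‖v^{n+ℓ} − v^n‖² ≤ A t_ℓ` for all
`ℓ ∈ {1, …, N−1}`, the piecewise-constant function `v(t) = v^n` for
`t ∈ (t_{n−1}, t_n]` (realised as `t ↦ v^{⌈tN/T⌉}`) satisfies
`∫₀^T ∫₀^T ‖v(t) − v(s)‖² / |t−s|^{1+2β} dt ds ≤ C A`. -/
theorem piecewiseConstant_fractional_sobolev_bound (β T : ℝ)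
    (hβ : β ∈ Set.Ioo (0:ℝ) (1/2)) (hT : 0 < T) :
    ∃ C : ℝ, 0 < C ∧
      ∀ (N : ℕ), 1 ≤ N →
      ∀ (V : Type) [NormedAddCommGroup V] (vs : ℕ → V) (A : ℝ), 0 ≤ A →
        (∀ ℓ : ℕ, 1 ≤ ℓ → ℓ ≤ N - 1 →
          (T / N) * ∑ n ∈ Finset.Icc 1 (N - ℓ), ‖vs (n + ℓ) - vs n‖ ^ 2
            ≤ A * ((ℓ : ℝ) * (T / N))) →
        (∫⁻ t in Set.Ioo (0:ℝ) T, ∫⁻ s in Set.Ioo (0:ℝ) T,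
            (‖vs ⌈t * N / T⌉₊ - vs ⌈s * N / T⌉₊‖₊ : ENNReal) ^ 2
              / ENNReal.ofReal (|t - s| ^ (1 + 2 * β)))
          ≤ ENNReal.ofReal (C * A) := by
  have hfin := kernel_fin β T hβ hT
  set J := ∫⁻ h in Set.Ioo (-T) T, ENNReal.ofReal (|h| ^ (-2 * β)) with hJ
  refine ⟨3 * J.toReal + 1, by positivity, ?_⟩
  intro N hN V _ vs A hA H0
  have hN' : (0:ℝ) < N := by exact_mod_cast hN
  have H : ∀ ℓ : ℕ, 1 ≤ ℓ →
      ∑ n ∈ Finset.Icc 1 (N - ℓ), ‖vs (n + ℓ) - vs n‖ ^ 2 ≤ A * ℓ := by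
    intro l hl
    by_cases hlN : l ≤ N - 1
    · have h1 := H0 l hl hlN
      have hτ : 0 < T / N := by positivity
      refine le_of_mul_le_mul_left ?_ hτ
      linarith
    · have : N - l = 0 := by omega
      rw [this]
      simp only [Finset.Icc_eq_empty_of_lt one_pos, Finset.sum_empty]
      positivity
  -- the numerator
  let G : ℝ → ℝ → ENNReal := fun t s => if t ∈ Set.Ioo 0 T ∧ s ∈ Set.Ioo 0 T then
      (‖vs ⌈t * N / T⌉₊ - vs ⌈s * N / T⌉₊‖₊ : ENNReal) ^ 2 else 0
  have hGm : Measurable (fun p : ℝ × ℝ => G p.1 p.2) := by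
    refine Measurable.ite ?_ ?_ measurable_const
    · exact (measurableSet_Ioo.prod measurableSet_Ioo :
        MeasurableSet ((Set.Ioo (0:ℝ) T) ×ˢ (Set.Ioo (0:ℝ) T)))
    · have hq : Measurable (fun q : ℕ × ℕ => (‖vs q.1 - vs q.2‖₊ : ENNReal) ^ 2) :=
        Measurable.of_discrete
      have hp : Measurable (fun p : ℝ × ℝ => (⌈p.1 * N / T⌉₊, ⌈p.2 * N / T⌉₊)) :=
        (Nat.measurable_ceil.comp (by fun_prop)).prodMk (Nat.measurable_ceil.comp (by fun_prop))
      exact hq.comp hp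
  have hGs : ∀ t s, G t s = G s t := by
    intro t s
    simp only [G]
    rw [aux_nnnorm_rev]
    exact if_congr and_comm rfl rfl
  let W : ℝ → ENNReal := fun h => ENNReal.ofReal (|h| ^ (1 + 2 * β))
  have hWm : Measurable W := by
    simp only [W]
    fun_prop
  have hpos : ∀ h, 0 < h → ∫⁻ t, G t (t + h) ≤ ENNReal.ofReal (3 * A * |h|) := by
    intro h hh
    rw [abs_of_pos hh]
    exact shift_bound T hT N hN vs A hA H h hh
  have hne : ∀ h, h ≠ 0 → ∫⁻ t, G t (t + h) ≤ ENNReal.ofReal (3 * A * |h|) := by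
    intro h hh
    rcases lt_or_gt_of_ne hh with hlt | hgt
    · have := hpos (-h) (by linarith)
      rw [abs_neg] at this
      refine le_trans (le_of_eq ?_) this
      rw [← lintegral_add_right_eq_self (fun t => G t (t + -h)) h]
      refine lintegral_congr fun t => ?_
      rw [hGs, add_neg_cancel_right]
    · exact hpos h hgt
  have step1 : (∫⁻ t in Set.Ioo (0:ℝ) T, ∫⁻ s in Set.Ioo (0:ℝ) T,
            (‖vs ⌈t * N / T⌉₊ - vs ⌈s * N / T⌉₊‖₊ : ENNReal) ^ 2
              / ENNReal.ofReal (|t - s| ^ (1 + 2 * β)))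
      = ∫⁻ t, ∫⁻ s, G t s / W (s - t) := by
    rw [← lintegral_indicator measurableSet_Ioo]
    refine lintegral_congr fun t => ?_
    by_cases ht : t ∈ Set.Ioo 0 T
    · rw [Set.indicator_of_mem ht, ← lintegral_indicator measurableSet_Ioo]
      refine lintegral_congr fun s => ?_
      by_cases hs : s ∈ Set.Ioo 0 T
      · rw [Set.indicator_of_mem hs]
        simp only [G, W, if_pos (And.intro ht hs), abs_sub_comm]
      · rw [Set.indicator_of_notMem hs]
        simp only [G, hs, and_false, if_false, ENNReal.zero_div]
    · rw [Set.indicator_of_notMem ht]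
      simp only [G, ht, false_and, if_false, ENNReal.zero_div, lintegral_zero]
  have step2 : ∫⁻ t, ∫⁻ s, G t s / W (s - t) = ∫⁻ h, ∫⁻ t, G t (t + h) / W h := by
    have : ∀ t, ∫⁻ s, G t s / W (s - t) = ∫⁻ h, G t (t + h) / W h := by
      intro t
      rw [← lintegral_add_left_eq_self (fun s => G t s / W (s - t)) t]
      simp only [add_sub_cancel_left]
    simp_rw [this]
    refine lintegral_lintegral_swap (Measurable.aemeasurable ?_)
    have h1 : Measurable (fun p : ℝ × ℝ => G p.1 (p.1 + p.2)) :=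
      hGm.comp (measurable_fst.prodMk (measurable_fst.add measurable_snd))
    exact h1.div (hWm.comp measurable_snd)
  have step3 : ∀ h : ℝ, ∫⁻ t, G t (t + h) / W h ≤ (Set.Ioo (-T) T).indicator
      (fun h => ENNReal.ofReal (3 * A) * ENNReal.ofReal (|h| ^ (-2 * β))) h := by
    intro h
    have hm : Measurable (fun t => G t (t + h)) :=
      hGm.comp (measurable_id.prodMk (measurable_id.add_const h))
    by_cases hh : h ∈ Set.Ioo (-T) T
    · rw [Set.indicator_of_mem hh]
      by_cases h0 : h = 0
      · subst h0
        have : ∀ t, G t (t + 0) / W 0 = 0 := by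
          intro t
          simp [G]
        simp only [this, lintegral_zero, zero_le]
      · have ha : 0 < |h| := abs_pos.2 h0
        simp_rw [div_eq_mul_inv]
        rw [lintegral_mul_const _ hm]
        refine (mul_le_mul_left (hne h h0) _).trans (le_of_eq ?_)
        have hp : 0 < |h| ^ (1 + 2 * β) := Real.rpow_pos_of_pos ha _
        simp only [W]
        rw [← ENNReal.ofReal_inv_of_pos hp, ← ENNReal.ofReal_mul (by positivity),
          ← ENNReal.ofReal_mul (by positivity), mul_assoc]
        congr 2
        rw [← Real.rpow_neg ha.le]
        nth_rewrite 1 [← Real.rpow_one |h|]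
        rw [← Real.rpow_add ha]
        congr 1
        ring
    · rw [Set.indicator_of_notMem hh]
      have : ∀ t, G t (t + h) = 0 := by
        intro t
        refine if_neg ?_
        rintro ⟨⟨a, b⟩, c, d⟩
        exact hh ⟨by linarith, by linarith⟩
      simp only [this, ENNReal.zero_div, lintegral_zero, le_refl]
  rw [step1, step2]
  refine (lintegral_mono step3).trans ?_
  rw [lintegral_indicator measurableSet_Ioo, lintegral_const_mul' _ _ ENNReal.ofReal_ne_top, ← hJ,
    ← ENNReal.ofReal_toReal hfin, ← ENNReal.ofReal_mul (by positivity)]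
  refine ENNReal.ofReal_le_ofReal ?_
  rw [ENNReal.toReal_ofReal ENNReal.toReal_nonneg]
  nlinarith
end
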